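/- There exists a symmetric linear functional Tr' : U → ℂ (i.e. Tr'(xy) = Tr'(yx) for all x, y ∈ U) such that the induced pairing between the center and the 0-th Hochschild homology is non-degenerate: for every nonzero z ∈ Z(U) there exists x ∈ U with Tr'(z x) ≠ 0, and for every x ∈ U with x ∉ [U,U] there exists z ∈ Z(U) with Tr'(z x) ≠ 0. -/

import Mathlib

open scoped TensorProduct
open Finset

noncomputable section

namespace LogHennings

/-- `q = exp(iπ/p)`. -/
def qq (p : ℕ) : ℂ := Complex.exp ((Real.pi : ℂ) * Complex.I / (p : ℂ))

/-- `q^{1/2} = exp(iπ/(2p))`. -/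
def qh (p : ℕ) : ℂ := Complex.exp ((Real.pi : ℂ) * Complex.I / (2 * (p : ℂ)))

/-- quantum integer `[m] = (q^m - q^{-m})/(q - q⁻¹)`. -/
def qnum (p m : ℕ) : ℂ := ((qq p) ^ m - (qq p)⁻¹ ^ m) / (qq p - (qq p)⁻¹)

/-- quantum factorial `[m]! = [m][m-1]⋯[1]`. -/
def qfac (p : ℕ) : ℕ → ℂ
  | 0 => 1
  | m + 1 => qnum p (m + 1) * qfac p m

/-- Generators of the restricted quantum group `U`. -/
inductive UGen | E | F | K | Kinv

abbrev FU := FreeAlgebra ℂ UGen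

def fE : FU := FreeAlgebra.ι ℂ UGen.E
def fF : FU := FreeAlgebra.ι ℂ UGen.F
def fK : FU := FreeAlgebra.ι ℂ UGen.K
def fKinv : FU := FreeAlgebra.ι ℂ UGen.Kinv

/-- Defining relations of the restricted quantum group `U`. -/
inductive URel (p : ℕ) : FU → FU → Prop
  | Epow : URel p (fE ^ p) 0
  | Fpow : URel p (fF ^ p) 0
  | Kpow : URel p (fK ^ (2 * p)) 1
  | KKinv : URel p (fK * fKinv) 1
  | KinvK : URel p (fKinv * fK) 1
  | KE : URel p (fK * fE * fKinv) ((qq p) ^ 2 • fE)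
  | KF : URel p (fK * fF * fKinv) (((qq p) ^ 2)⁻¹ • fF)
  | EF : URel p (fE * fF - fF * fE) ((qq p - (qq p)⁻¹)⁻¹ • (fK - fKinv))

/-- The restricted quantum group `U = \bar U_q(sl2)`. -/
abbrev Uq (p : ℕ) := RingQuot (URel p)

def UE (p : ℕ) : Uq p := RingQuot.mkAlgHom ℂ (URel p) fE
def UF (p : ℕ) : Uq p := RingQuot.mkAlgHom ℂ (URel p) fF
def UK (p : ℕ) : Uq p := RingQuot.mkAlgHom ℂ (URel p) fK
def UKinv (p : ℕ) : Uq p := RingQuot.mkAlgHom ℂ (URel p) fKinv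

/-- Generators of the braided extension `D`. -/
inductive DGen | e | phi | k | kinv

abbrev FD := FreeAlgebra ℂ DGen

def fe : FD := FreeAlgebra.ι ℂ DGen.e
def fphi : FD := FreeAlgebra.ι ℂ DGen.phi
def fk : FD := FreeAlgebra.ι ℂ DGen.k
def fkinv : FD := FreeAlgebra.ι ℂ DGen.kinv

/-- Defining relations of `D`. -/
inductive DRel (p : ℕ) : FD → FD → Prop
  | epow : DRel p (fe ^ p) 0
  | phipow : DRel p (fphi ^ p) 0
  | kpow : DRel p (fk ^ (4 * p)) 1
  | kkinv : DRel p (fk * fkinv) 1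
  | kinvk : DRel p (fkinv * fk) 1
  | ke : DRel p (fk * fe * fkinv) (qq p • fe)
  | kphi : DRel p (fk * fphi * fkinv) ((qq p)⁻¹ • fphi)
  | ephi : DRel p (fe * fphi - fphi * fe)
      ((qq p - (qq p)⁻¹)⁻¹ • (fk ^ 2 - fkinv ^ 2))

/-- The braided extension `D` of `U`. -/
abbrev Dq (p : ℕ) := RingQuot (DRel p)

def De (p : ℕ) : Dq p := RingQuot.mkAlgHom ℂ (DRel p) fe
def Dphi (p : ℕ) : Dq p := RingQuot.mkAlgHom ℂ (DRel p) fphi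
def Dk (p : ℕ) : Dq p := RingQuot.mkAlgHom ℂ (DRel p) fk
def Dkinv (p : ℕ) : Dq p := RingQuot.mkAlgHom ℂ (DRel p) fkinv

/-- The `R`-matrix of `D`. -/
def Rmat (p : ℕ) : Dq p ⊗[ℂ] Dq p :=
  ((4 * (p : ℂ))⁻¹) •
    ∑ m ∈ range p, ∑ n ∈ range (4 * p), ∑ j ∈ range (4 * p),
      (((qq p - (qq p)⁻¹) ^ m / qfac p m) *
          (qh p) ^ ((m : ℤ) * ((m : ℤ) - 1) + 2 * (m : ℤ) * ((n : ℤ) - (j : ℤ))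
            - (n : ℤ) * (j : ℤ))) •
        ((De p ^ m * Dk p ^ n) ⊗ₜ[ℂ] (Dphi p ^ m * Dk p ^ j))

/-- `R₂₁ = τ(R)`. -/
def R21 (p : ℕ) : Dq p ⊗[ℂ] Dq p := TensorProduct.comm ℂ (Dq p) (Dq p) (Rmat p)

/-- The monodromy `M = R₂₁ R`. -/
def Mmat (p : ℕ) : Dq p ⊗[ℂ] Dq p := R21 p * Rmat p

/-- The ribbon element `r ∈ D`. -/
def rib (p : ℕ) : Dq p :=
  ((1 - Complex.I) / (2 * (Real.sqrt p : ℂ))) •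
    ∑ m ∈ range p, ∑ j ∈ range (2 * p),
      (((qq p - (qq p)⁻¹) ^ m / qfac p m) *
          (qh p) ^ (-(m : ℤ) + 2 * (m : ℤ) * (j : ℤ) + ((j : ℤ) + (p : ℤ) + 1) ^ 2)) •
        (Dphi p ^ m * De p ^ m * Dk p ^ (2 * j))

/-- The Drinfeld element `u = Σ S(β_i) α_i` for `R = Σ α_i ⊗ β_i`,
depending on a choice of antipode `S`. -/
def drinfeldU (p : ℕ) (S : Dq p →ₗ[ℂ] Dq p) : Dq p :=
  LinearMap.mul' ℂ (Dq p) (TensorProduct.map S LinearMap.id (R21 p))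

/-- `Δ` takes the prescribed values on the generators of `U`. -/
def IsDeltaU (p : ℕ) (Δ : Uq p →ₐ[ℂ] Uq p ⊗[ℂ] Uq p) : Prop :=
  Δ (UE p) = 1 ⊗ₜ[ℂ] UE p + UE p ⊗ₜ[ℂ] UK p ∧
  Δ (UF p) = UKinv p ⊗ₜ[ℂ] UF p + UF p ⊗ₜ[ℂ] 1 ∧
  Δ (UK p) = UK p ⊗ₜ[ℂ] UK p ∧
  Δ (UKinv p) = UKinv p ⊗ₜ[ℂ] UKinv p

/-- `ε` takes the prescribed values on the generators of `U`. -/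
def IsCounitU (p : ℕ) (ε : Uq p →ₐ[ℂ] ℂ) : Prop :=
  ε (UE p) = 0 ∧ ε (UF p) = 0 ∧ ε (UK p) = 1 ∧ ε (UKinv p) = 1

/-- `S` is an algebra anti-homomorphism taking the prescribed values on the
generators of `U`. -/
def IsAntipodeU (p : ℕ) (S : Uq p →ₗ[ℂ] Uq p) : Prop :=
  S 1 = 1 ∧ (∀ x y, S (x * y) = S y * S x) ∧
  S (UE p) = -(UE p * UKinv p) ∧ S (UF p) = -(UK p * UF p) ∧
  S (UK p) = UKinv p ∧ S (UKinv p) = UK p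

/-- `Δ` takes the prescribed values on the generators of `D`. -/
def IsDeltaD (p : ℕ) (Δ : Dq p →ₐ[ℂ] Dq p ⊗[ℂ] Dq p) : Prop :=
  Δ (De p) = 1 ⊗ₜ[ℂ] De p + De p ⊗ₜ[ℂ] (Dk p ^ 2) ∧
  Δ (Dphi p) = (Dkinv p ^ 2) ⊗ₜ[ℂ] Dphi p + Dphi p ⊗ₜ[ℂ] 1 ∧
  Δ (Dk p) = Dk p ⊗ₜ[ℂ] Dk p ∧
  Δ (Dkinv p) = Dkinv p ⊗ₜ[ℂ] Dkinv p

/-- `ε` takes the prescribed values on the generators of `D`. -/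
def IsCounitD (p : ℕ) (ε : Dq p →ₐ[ℂ] ℂ) : Prop :=
  ε (De p) = 0 ∧ ε (Dphi p) = 0 ∧ ε (Dk p) = 1 ∧ ε (Dkinv p) = 1

/-- `S` is an algebra anti-homomorphism taking the prescribed values on the
generators of `D`. -/
def IsAntipodeD (p : ℕ) (S : Dq p →ₗ[ℂ] Dq p) : Prop :=
  S 1 = 1 ∧ (∀ x y, S (x * y) = S y * S x) ∧
  S (De p) = -(De p * Dkinv p ^ 2) ∧ S (Dphi p) = -(Dk p ^ 2 * Dphi p) ∧
  S (Dk p) = Dkinv p ∧ S (Dkinv p) = Dk p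

/-- `ι` takes the prescribed values `E ↦ e`, `F ↦ φ`, `K^{±1} ↦ k^{±2}`. -/
def IsIota (p : ℕ) (ι : Uq p →ₐ[ℂ] Dq p) : Prop :=
  ι (UE p) = De p ∧ ι (UF p) = Dphi p ∧ ι (UK p) = Dk p ^ 2 ∧
  ι (UKinv p) = Dkinv p ^ 2

/-- `μ` takes the prescribed values on the PBW basis of `U`. -/
def IsMu (p : ℕ) (μ : Uq p →ₗ[ℂ] ℂ) : Prop :=
  ∀ m n l : ℕ, m < p → n < p → l < 2 * p →
    μ (UE p ^ m * UF p ^ n * UK p ^ l) =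
      if m = p - 1 ∧ n = p - 1 ∧ l = p + 1 then
        -((Real.sqrt (2 / (p : ℝ)) : ℂ)) * (qfac p (p - 1)) ^ 2
      else 0

variable {A : Type*} [Ring A] [Algebra ℂ A]

/-- Coassociativity of a comultiplication. -/
def Coassoc (Δ : A →ₐ[ℂ] A ⊗[ℂ] A) : Prop :=
  ∀ x, TensorProduct.assoc ℂ A A A
      (TensorProduct.map Δ.toLinearMap LinearMap.id (Δ x)) =
    TensorProduct.map LinearMap.id Δ.toLinearMap (Δ x)

/-- The counit axiom. -/
def CounitAxiom (Δ : A →ₐ[ℂ] A ⊗[ℂ] A) (ε : A →ₐ[ℂ] ℂ) : Prop :=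
  (∀ x, TensorProduct.lid ℂ A
      (TensorProduct.map ε.toLinearMap LinearMap.id (Δ x)) = x) ∧
  (∀ x, TensorProduct.rid ℂ A
      (TensorProduct.map LinearMap.id ε.toLinearMap (Δ x)) = x)

/-- The antipode axiom. -/
def AntipodeAxiom (Δ : A →ₐ[ℂ] A ⊗[ℂ] A) (ε : A →ₐ[ℂ] ℂ)
    (S : A →ₗ[ℂ] A) : Prop :=
  (∀ x, LinearMap.mul' ℂ A (TensorProduct.map S LinearMap.id (Δ x)) = ε x • 1) ∧
  (∀ x, LinearMap.mul' ℂ A (TensorProduct.map LinearMap.id S (Δ x)) = ε x • 1)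

/-- `x ↦ x ⊗ 1`. -/
def e1 (p : ℕ) : Dq p →ₗ[ℂ] Dq p ⊗[ℂ] Dq p :=
  (TensorProduct.mk ℂ (Dq p) (Dq p)).flip 1

/-- `x ↦ 1 ⊗ x`. -/
def e2 (p : ℕ) : Dq p →ₗ[ℂ] Dq p ⊗[ℂ] Dq p :=
  TensorProduct.mk ℂ (Dq p) (Dq p) 1

/-- The balancing element `g = K^{p+1}`. -/
def gU (p : ℕ) : Uq p := UK p ^ (p + 1)

/-- The span of commutators `[U,U]`. -/
def commSpan (p : ℕ) : Submodule ℂ (Uq p) :=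
  Submodule.span ℂ {z : Uq p | ∃ x y : Uq p, z = x * y - y * x}

end LogHennings

namespace LogHennings

lemma aux_EpowF {A : Type*} [Ring A] [Algebra ℂ A] (E F K K' : A) (r c : ℂ) 
    (hKE : K * E = r • (E * K)) (hK'E : K' * E = r⁻¹ • (E * K'))
    (hEF : E * F = F * E + c • (K - K')) (n : ℕ) :
    E ^ (n + 1) * F = F * E ^ (n + 1) +
      E ^ n * ((c * ∑ k ∈ range (n + 1), r ^ k) • K - (c * ∑ k ∈ range (n + 1), r⁻¹ ^ k) • K') := by
  have h1 : ∀ n : ℕ, K * E ^ n = r ^ n • (E ^ n * K) := by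
    intro n
    induction n with
    | zero => simp
    | succ n ih =>
      rw [pow_succ, ← mul_assoc, ih, smul_mul_assoc, mul_assoc, hKE, mul_smul_comm, smul_smul,
        mul_assoc, pow_succ]
  have h2 : ∀ n : ℕ, K' * E ^ n = r⁻¹ ^ n • (E ^ n * K') := by
    intro n
    induction n with
    | zero => simp
    | succ n ih =>
      rw [pow_succ, ← mul_assoc, ih, smul_mul_assoc, mul_assoc, hK'E, mul_smul_comm, smul_smul,
        mul_assoc, pow_succ]
  induction n with
  | zero => simp [hEF, smul_sub]
  | succ n ih =>
    have e : E ^ (n + 1 + 1) * F = E * (E ^ (n + 1) * F) := by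
      rw [pow_succ' E (n + 1), mul_assoc]
    have e2 : E * (F * E ^ (n + 1)) = F * E ^ (n + 1 + 1) +
        c • (r ^ (n + 1) • (E ^ (n + 1) * K) - r⁻¹ ^ (n + 1) • (E ^ (n + 1) * K')) := by
      rw [← mul_assoc, hEF, add_mul, mul_assoc, ← pow_succ', smul_mul_assoc, sub_mul, h1, h2]
    rw [e, ih, mul_add, e2, ← mul_assoc, ← pow_succ', sum_range_succ _ (n + 1),
      sum_range_succ (fun k => r⁻¹ ^ k) (n + 1)]
    simp only [mul_sub, mul_smul_comm, smul_sub, smul_smul, mul_add, add_smul]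
    abel

lemma aux_EpowF' {A : Type*} [Ring A] [Algebra ℂ A] (E F K K' : A) (r c : ℂ)
    (hKE : K * E = r • (E * K)) (hK'E : K' * E = r⁻¹ • (E * K'))
    (hEF : E * F = F * E + c • (K - K')) (n : ℕ) :
    ∃ a b : ℂ, E ^ (n + 1) * F = F * E ^ (n + 1) + E ^ n * (a • K + b • K') := by
  refine ⟨c * ∑ k ∈ range (n + 1), r ^ k, -(c * ∑ k ∈ range (n + 1), r⁻¹ ^ k), ?_⟩
  rw [neg_smul, ← sub_eq_add_neg]
  exact aux_EpowF E F K K' r c hKE hK'E hEF n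

lemma aux_EFpow {A : Type*} [Ring A] [Algebra ℂ A] (E F K K' : A) (r c : ℂ)
    (hKF : K * F = r⁻¹ • (F * K)) (hK'F : K' * F = r • (F * K'))
    (hEF : E * F = F * E + c • (K - K')) (n : ℕ) :
    ∃ a b : ℂ, E * F ^ (n + 1) = F ^ (n + 1) * E + F ^ n * (a • K + b • K') := by
  induction n with
  | zero => exact ⟨c, -c, by simp [hEF, sub_eq_add_neg]⟩
  | succ n ih =>
    obtain ⟨a, b, h⟩ := ih
    refine ⟨c + a * r⁻¹, -c + b * r, ?_⟩
    rw [pow_succ F (n + 1), ← mul_assoc, h, add_mul, mul_assoc _ E F, hEF, mul_assoc _ _ F, add_mul,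
      smul_mul_assoc, smul_mul_assoc, hKF, hK'F, pow_succ F n]
    simp only [mul_add, mul_sub, mul_smul_comm, smul_sub, smul_smul, add_smul, neg_smul, mul_neg,
      ← mul_assoc]
    abel

lemma qq_prim (p : ℕ) (hp : 2 ≤ p) : IsPrimitiveRoot (qq p) (2 * p) := by
  have h := Complex.isPrimitiveRoot_exp (2 * p) (by omega)
  convert h using 1
  unfold qq
  congr 1
  have : (p : ℂ) ≠ 0 := by exact_mod_cast (by omega : p ≠ 0)
  push_cast
  field_simp

lemma qq_ne (p : ℕ) : qq p ≠ 0 := Complex.exp_ne_zero _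

lemma qq_sq_prim (p : ℕ) (hp : 2 ≤ p) : IsPrimitiveRoot (qq p ^ 2) p :=
  (qq_prim p hp).pow (by omega) rfl

lemma geom0 (p : ℕ) (hp : 2 ≤ p) : ∑ k ∈ range p, (qq p ^ 2) ^ k = 0 :=
  (qq_sq_prim p hp).geom_sum_eq_zero (by omega)

lemma geom0' (p : ℕ) (hp : 2 ≤ p) : ∑ k ∈ range p, (qq p ^ 2)⁻¹ ^ k = 0 :=
  (qq_sq_prim p hp).inv.geom_sum_eq_zero (by omega)

/-- The space with basis `F^i E^m`. -/
abbrev VV (p : ℕ) := (Fin p × Fin p) → ℂ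

def vec (p i m : ℕ) : VV p := fun x => if (x.1 : ℕ) = i ∧ (x.2 : ℕ) = m then 1 else 0

lemma vec_zero (p i m : ℕ) (h : p ≤ i ∨ p ≤ m) : vec p i m = 0 := by
  ext x
  have := x.1.2
  have := x.2.2
  simp only [vec, Pi.zero_apply, ite_eq_right_iff]
  intro; omega

lemma vec_single (p : ℕ) (x : Fin p × Fin p) : vec p x.1 x.2 = Pi.single x 1 := by
  ext y
  simp only [vec, Pi.single_apply, Prod.ext_iff, Fin.ext_iff]

lemma op_exists (p : ℕ) (W : Type*) [AddCommGroup W] [Module ℂ W] (g : ℕ → ℕ → W)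
    (hg : ∀ i m, p ≤ i ∨ p ≤ m → g i m = 0) :
    ∃ L : VV p →ₗ[ℂ] W, ∀ i m, L (vec p i m) = g i m := by
  refine ⟨Fintype.linearCombination ℂ (fun x : Fin p × Fin p => g x.1 x.2), fun i m => ?_⟩
  by_cases h : p ≤ i ∨ p ≤ m
  · rw [vec_zero p i m h, map_zero, hg i m h]
  · push Not at h
    have := vec_single p (⟨i, h.1⟩, ⟨m, h.2⟩)
    simp only at this
    rw [this, Fintype.linearCombination_apply_single]
    simp

lemma op_ext (p : ℕ) {W : Type*} [AddCommGroup W] [Module ℂ W] (L M : VV p →ₗ[ℂ] W)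
    (h : ∀ i m, i < p → m < p → L (vec p i m) = M (vec p i m)) : L = M := by
  refine (Pi.basisFun ℂ (Fin p × Fin p)).ext fun x => ?_
  rw [Pi.basisFun_apply, ← vec_single]
  exact h _ _ x.1.2 x.2.2

lemma rep_exists (p : ℕ) (hp : 2 ≤ p) (κ : ℂ) (hκ : κ ^ (2 * p) = 1) :
    ∃ ρ : Uq p →ₐ[ℂ] Module.End ℂ (VV p),
      (∀ i m, ρ (UF p) (vec p i m) = vec p (i + 1) m) ∧
      (∀ m, ρ (UE p) (vec p 0 m) = vec p 0 (m + 1)) ∧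
      (ρ (UK p) (vec p 0 0) = κ • vec p 0 0) := by
  set q := qq p with hq
  have hq0 : q ≠ 0 := qq_ne p
  have hκ0 : κ ≠ 0 := by
    rintro rfl
    rw [zero_pow (by omega)] at hκ
    exact zero_ne_one hκ
  set c := (q - q⁻¹)⁻¹ with hc
  -- weights
  let w : ℕ → ℕ → ℂ := fun i m => κ * (q ^ 2) ^ m * (q ^ 2)⁻¹ ^ i
  have hw0 : ∀ i m, w i m ≠ 0 := fun i m => by simp only [w]; positivity
  have hwi : ∀ i m, w (i + 1) m = (q ^ 2)⁻¹ * w i m := fun i m => by simp only [w]; ring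
  have hwm : ∀ i m, w i (m + 1) = q ^ 2 * w i m := fun i m => by simp only [w]; ring
  let γ : ℕ → ℕ → ℂ := fun i m => ∑ k ∈ range i, c * (w k m - (w k m)⁻¹)
  have hγ0 : ∀ m, γ 0 m = 0 := fun m => by simp [γ]
  have hγs : ∀ i m, γ (i + 1) m = γ i m + c * (w i m - (w i m)⁻¹) := fun i m => by
    simp [γ, sum_range_succ]
  have hγp : ∀ m, γ p m = 0 := fun m => by
    simp only [γ, w, ← mul_sum, sum_sub_distrib, mul_inv_rev, ← inv_pow, inv_inv]
    have h2 := geom0' p hp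
    rw [← inv_pow] at h2
    rw [← sum_mul, geom0 p hp, h2]
    simp
  obtain ⟨F, hF⟩ := op_exists p (VV p) (fun i m => vec p (i + 1) m)
    (fun i m h => vec_zero _ _ _ (by omega))
  obtain ⟨K, hK⟩ := op_exists p (VV p) (fun i m => w i m • vec p i m)
    (fun i m h => by rw [vec_zero _ _ _ h, smul_zero])
  obtain ⟨K', hK'⟩ := op_exists p (VV p) (fun i m => (w i m)⁻¹ • vec p i m)
    (fun i m h => by rw [vec_zero _ _ _ h, smul_zero])
  obtain ⟨E, hE⟩ := op_exists p (VV p) (fun i m => vec p i (m + 1) + γ i m • vec p (i - 1) m)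
    (fun i m h => by
      rw [vec_zero p i (m + 1) (by omega), zero_add]
      by_cases h1 : i = p
      · rw [h1, hγp, zero_smul]
      · rw [vec_zero p (i - 1) m (by omega), smul_zero])
  have rKK' : K * K' = 1 := op_ext p _ _ fun i m _ _ => by
    rw [Module.End.mul_apply, hK', map_smul, hK, smul_smul, inv_mul_cancel₀ (hw0 i m), one_smul]; rfl
  have rK'K : K' * K = 1 := op_ext p _ _ fun i m _ _ => by
    rw [Module.End.mul_apply, hK, map_smul, hK', smul_smul, mul_inv_cancel₀ (hw0 i m), one_smul]; rfl
  have powK : ∀ n i m, (K ^ n) (vec p i m) = (w i m) ^ n • vec p i m := by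
    intro n i m
    induction n with
    | zero => simp
    | succ n ih => rw [pow_succ, Module.End.mul_apply, hK, map_smul, ih, smul_smul, pow_succ']
  have powF : ∀ n i m, (F ^ n) (vec p i m) = vec p (i + n) m := by
    intro n
    induction n with
    | zero => simp
    | succ n ih =>
      intro i m
      rw [pow_succ, Module.End.mul_apply, hF, ih]; congr 1; omega
  have hE0 : ∀ m, E (vec p 0 m) = vec p 0 (m + 1) := fun m => by rw [hE, hγ0]; simp
  have powE : ∀ n m, (E ^ n) (vec p 0 m) = vec p 0 (m + n) := by
    intro n
    induction n with
    | zero => simp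
    | succ n ih =>
      intro m
      rw [pow_succ, Module.End.mul_apply, hE0, ih]; congr 1; omega
  have hq2p : (q ^ 2) ^ p = 1 := (qq_sq_prim p hp).pow_eq_one
  have rKp : K ^ (2 * p) = 1 := op_ext p _ _ fun i m _ _ => by
    rw [powK]
    have : w i m ^ (2 * p) = 1 := by
      simp only [w, mul_pow]
      rw [hκ, ← pow_mul (q ^ 2), ← pow_mul (q ^ 2)⁻¹, show m * (2 * p) = p * (2 * m) by ring,
        show i * (2 * p) = p * (2 * i) by ring, pow_mul (q ^ 2), pow_mul (q ^ 2)⁻¹, inv_pow, hq2p]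
      simp
    rw [this, one_smul]; rfl
  have rFp : F ^ p = 0 := op_ext p _ _ fun i m _ _ => by
    rw [powF, vec_zero _ _ _ (by omega)]; rfl
  have rKE : K * E = (q ^ 2) • (E * K) := op_ext p _ _ fun i m _ _ => by
    simp only [Module.End.mul_apply, LinearMap.smul_apply, hE, hK, map_add, map_smul]
    rcases i with _ | i
    · simp [hγ0, hwm, smul_smul]
    · simp only [hwm, Nat.add_sub_cancel, smul_add, smul_smul, hwi]
      congr 2
      field_simp
  have rKF : K * F = (q ^ 2)⁻¹ • (F * K) := op_ext p _ _ fun i m _ _ => by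
    simp only [Module.End.mul_apply, LinearMap.smul_apply, hF, hK, map_smul, hwi, smul_smul]
  have rEF : E * F - F * E = c • (K - K') := op_ext p _ _ fun i m _ _ => by
    simp only [Module.End.mul_apply, LinearMap.sub_apply, LinearMap.smul_apply, hF, hE, hK, hK',
      map_add, map_smul, hγs, Nat.add_sub_cancel]
    rcases i with _ | i
    · simp only [hγ0, zero_smul, zero_add, add_zero, add_sub_cancel_left]
      simp only [mul_sub, smul_sub, smul_smul, sub_smul]
    · simp only [Nat.add_sub_cancel, add_smul, mul_sub, smul_sub, smul_smul, sub_smul]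
      abel
  have rK'E : K' * E = (q ^ 2)⁻¹ • (E * K') := by
    have : K' * (K * E) * K' = K' * ((q ^ 2) • (E * K)) * K' := by rw [rKE]
    rw [← mul_assoc, rK'K, one_mul, mul_smul_comm, smul_mul_assoc, mul_assoc, mul_assoc, rKK',
      mul_one] at this
    rw [this, smul_smul, inv_mul_cancel₀ (by positivity), one_smul]
  have comm : E ^ p * F = F * E ^ p := by
    have := aux_EpowF E F K K' (q ^ 2) c rKE rK'E (by rw [← rEF]; abel) (p - 1)
    rw [show p - 1 + 1 = p by omega, geom0 p hp, geom0' p hp] at this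
    simpa using this
  have rEp : E ^ p = 0 := op_ext p _ _ fun i m _ _ => by
    have h1 := powF i 0 m
    rw [zero_add] at h1
    have h2 : Commute (E ^ p) (F ^ i) := Commute.pow_right comm i
    rw [← h1, ← Module.End.mul_apply, h2.eq, Module.End.mul_apply, powE,
      vec_zero p 0 (m + p) (by omega), map_zero]
    rfl
  let φ : FU →ₐ[ℂ] Module.End ℂ (VV p) := FreeAlgebra.lift ℂ (fun g => match g with
    | UGen.E => E | UGen.F => F | UGen.K => K | UGen.Kinv => K')
  have φE : φ fE = E := by simp [φ, fE]
  have φF : φ fF = F := by simp [φ, fF]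
  have φK : φ fK = K := by simp [φ, fK]
  have φK' : φ fKinv = K' := by simp [φ, fKinv]
  have hrel : ∀ ⦃x y : FU⦄, URel p x y → φ x = φ y := by
    intro x y h
    cases h with
    | Epow => rw [map_pow, φE, rEp, map_zero]
    | Fpow => rw [map_pow, φF, rFp, map_zero]
    | Kpow => rw [map_pow, φK, rKp, map_one]
    | KKinv => rw [map_mul, φK, φK', rKK', map_one]
    | KinvK => rw [map_mul, φK, φK', rK'K, map_one]
    | KE => rw [map_mul, map_mul, map_smul, φK, φK', φE, rKE, smul_mul_assoc, mul_assoc, rKK', mul_one]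
    | KF => rw [map_mul, map_mul, map_smul, φK, φK', φF, rKF, smul_mul_assoc, mul_assoc, rKK', mul_one]
    | EF => rw [map_sub, map_mul, map_mul, map_smul, map_sub, φK, φK', φE, φF, rEF]
  let ρ := RingQuot.liftAlgHom ℂ (s := URel p) ⟨φ, hrel⟩
  have hρ : ∀ x, ρ (RingQuot.mkAlgHom ℂ (URel p) x) = φ x := fun x =>
    RingQuot.liftAlgHom_mkAlgHom_apply ℂ φ hrel x
  refine ⟨ρ, fun i m => ?_, fun m => ?_, ?_⟩
  · rw [UF, hρ, φF, hF]
  · rw [UE, hρ, φE, hE0]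
  · rw [UK, hρ, φK, hK]; simp [w]

lemma t_exists (p : ℕ) (hp : 2 ≤ p) (κ : ℂ) (hκ : κ ^ (2 * p) = 1) :
    ∃ t : Uq p →ₗ[ℂ] ℂ, ∀ i m n, t (UF p ^ i * UE p ^ m * UK p ^ n) =
      if i = p - 1 ∧ m = p - 1 then κ ^ n else 0 := by
  obtain ⟨ρ, hF, hE, hK⟩ := rep_exists p hp κ hκ
  obtain ⟨co, hco⟩ := op_exists p ℂ (fun i m => if i = p - 1 ∧ m = p - 1 then 1 else 0)
    (fun i m h => by rw [if_neg]; omega)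
  have powK : ∀ n, (ρ (UK p) ^ n) (vec p 0 0) = κ ^ n • vec p 0 0 := by
    intro n
    induction n with
    | zero => simp
    | succ n ih => rw [pow_succ, Module.End.mul_apply, hK, map_smul, ih, smul_smul, pow_succ']
  have powF : ∀ n m, (ρ (UF p) ^ n) (vec p 0 m) = vec p n m := by
    intro n m
    induction n with
    | zero => simp
    | succ n ih => rw [pow_succ', Module.End.mul_apply, ih, hF]
  have powE : ∀ n, (ρ (UE p) ^ n) (vec p 0 0) = vec p 0 n := by
    intro n
    induction n with
    | zero => simp
    | succ n ih => rw [pow_succ', Module.End.mul_apply, ih, hE]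
  refine ⟨co ∘ₗ (LinearMap.applyₗ (vec p 0 0)) ∘ₗ ρ.toLinearMap, fun i m n => ?_⟩
  simp only [LinearMap.comp_apply, LinearMap.applyₗ_apply_apply, AlgHom.toLinearMap_apply, map_mul, map_pow,
    Module.End.mul_apply, powK, map_smul, powE, powF, hco]
  split_ifs <;> simp

lemma Tr_exists (p : ℕ) (hp : 2 ≤ p) :
    ∃ t : Uq p →ₗ[ℂ] ℂ, ∀ i m n, t (UF p ^ i * UE p ^ m * UK p ^ n) =
      if i = p - 1 ∧ m = p - 1 ∧ 2 * p ∣ n then 1 else 0 := by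
  have hpr := qq_prim p hp
  choose t ht using fun s : ℕ => t_exists p hp (qq p ^ s) (by
    rw [← pow_mul, mul_comm, pow_mul, hpr.pow_eq_one, one_pow])
  refine ⟨((2 * p : ℕ) : ℂ)⁻¹ • ∑ s ∈ range (2 * p), t s, fun i m n => ?_⟩
  have h0 : ((2 * p : ℕ) : ℂ) ≠ 0 := by exact_mod_cast (by omega : 2 * p ≠ 0)
  simp only [LinearMap.smul_apply, LinearMap.sum_apply, ht]
  by_cases h : i = p - 1 ∧ m = p - 1
  · simp only [h, and_self, if_true, true_and]
    have e : ∀ s, (qq p ^ s) ^ n = (qq p ^ n) ^ s := fun s => by rw [← pow_mul, ← pow_mul, mul_comm]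
    simp only [e]
    split_ifs with hd
    · rw [(hpr.pow_eq_one_iff_dvd n).2 hd]
      simp only [one_pow, sum_const, card_range, nsmul_eq_mul, mul_one, smul_eq_mul]
      exact inv_mul_cancel₀ h0
    · have h1 : qq p ^ n ≠ 1 := fun h => hd ((hpr.pow_eq_one_iff_dvd n).1 h)
      rw [geom_sum_eq h1, ← pow_mul, mul_comm n, pow_mul, hpr.pow_eq_one, one_pow]
      simp
  · simp only [h, if_false]
    rw [if_neg (by tauto)]
    simp

end LogHennings

namespace LogHennings

lemma rel_mk {p : ℕ} {x y : FU} (h : URel p x y) :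
    RingQuot.mkAlgHom ℂ (URel p) x = RingQuot.mkAlgHom ℂ (URel p) y :=
  RingQuot.mkAlgHom_rel ℂ h

lemma U_Ep (p : ℕ) : UE p ^ p = 0 := by
  simpa [UE] using rel_mk (URel.Epow (p := p))
lemma U_Fp (p : ℕ) : UF p ^ p = 0 := by
  simpa [UF] using rel_mk (URel.Fpow (p := p))
lemma U_Kp (p : ℕ) : UK p ^ (2 * p) = 1 := by
  simpa [UK] using rel_mk (URel.Kpow (p := p))
lemma U_KK' (p : ℕ) : UK p * UKinv p = 1 := by
  simpa [UK, UKinv] using rel_mk (URel.KKinv (p := p))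
lemma U_K'K (p : ℕ) : UKinv p * UK p = 1 := by
  simpa [UK, UKinv] using rel_mk (URel.KinvK (p := p))
lemma U_KE (p : ℕ) : UK p * UE p = (qq p ^ 2) • (UE p * UK p) := by
  have h : UK p * UE p * UKinv p = (qq p ^ 2) • UE p := by
    simpa only [UK, UKinv, UE, map_mul, map_smul] using rel_mk (URel.KE (p := p))
  rw [← smul_mul_assoc, ← h, mul_assoc _ _ (UK p), U_K'K, mul_one]
lemma U_KF (p : ℕ) : UK p * UF p = (qq p ^ 2)⁻¹ • (UF p * UK p) := by
  have h : UK p * UF p * UKinv p = (qq p ^ 2)⁻¹ • UF p := by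
    simpa only [UK, UKinv, UF, map_mul, map_smul] using rel_mk (URel.KF (p := p))
  rw [← smul_mul_assoc, ← h, mul_assoc _ _ (UK p), U_K'K, mul_one]
lemma U_EF (p : ℕ) : UE p * UF p = UF p * UE p + (qq p - (qq p)⁻¹)⁻¹ • (UK p - UKinv p) := by
  have h : UE p * UF p - UF p * UE p = (qq p - (qq p)⁻¹)⁻¹ • (UK p - UKinv p) := by
    simpa only [UK, UKinv, UF, UE, map_mul, map_smul, map_sub] using rel_mk (URel.EF (p := p))
  rw [← h]; abel
lemma U_K' (p : ℕ) (hp : 2 ≤ p) : UKinv p = UK p ^ (2 * p - 1) := by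
  have h : UK p ^ (2 * p - 1) * UK p = 1 := by
    rw [← pow_succ, show 2 * p - 1 + 1 = 2 * p by omega, U_Kp]
  calc UKinv p = (UK p ^ (2 * p - 1) * UK p) * UKinv p := by rw [h, one_mul]
    _ = _ := by rw [mul_assoc, U_KK', mul_one]

lemma q2_ne (p : ℕ) : qq p ^ 2 ≠ 0 := pow_ne_zero _ (qq_ne p)

/-- moving powers past each other -/
lemma pow_comm_smul {A : Type*} [Ring A] [Algebra ℂ A] (K X : A) (r : ℂ)
    (h : K * X = r • (X * K)) (n m : ℕ) : K ^ n * X ^ m = (r ^ (n * m)) • (X ^ m * K ^ n) := by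
  have h1 : ∀ m, K * X ^ m = r ^ m • (X ^ m * K) := by
    intro m
    induction m with
    | zero => simp
    | succ m ih =>
      rw [pow_succ, ← mul_assoc, ih, smul_mul_assoc, mul_assoc, h, mul_smul_comm, smul_smul,
        mul_assoc, pow_succ]
  induction n with
  | zero => simp
  | succ n ih =>
    rw [pow_succ', mul_assoc, ih, mul_smul_comm, ← mul_assoc, h1, smul_mul_assoc, smul_smul,
      mul_assoc, add_mul, one_mul, pow_add]

lemma U_K'F (p : ℕ) : UKinv p * UF p = (qq p ^ 2) • (UF p * UKinv p) := by
  have : UKinv p * (UK p * UF p) * UKinv p = UKinv p * ((qq p ^ 2)⁻¹ • (UF p * UK p)) * UKinv p := by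
    rw [U_KF]
  rw [← mul_assoc, U_K'K, one_mul, mul_smul_comm, smul_mul_assoc, mul_assoc, mul_assoc, U_KK',
    mul_one] at this
  rw [this, smul_smul, mul_inv_cancel₀ (q2_ne p), one_smul]

lemma U_K'E (p : ℕ) : UKinv p * UE p = (qq p ^ 2)⁻¹ • (UE p * UKinv p) := by
  have : UKinv p * (UK p * UE p) * UKinv p = UKinv p * ((qq p ^ 2) • (UE p * UK p)) * UKinv p := by
    rw [U_KE]
  rw [← mul_assoc, U_K'K, one_mul, mul_smul_comm, smul_mul_assoc, mul_assoc, mul_assoc, U_KK',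
    mul_one] at this
  rw [this, smul_smul, inv_mul_cancel₀ (q2_ne p), one_smul]

/-- PBW monomials -/
def mon (p i m n : ℕ) : Uq p := UF p ^ i * UE p ^ m * UK p ^ n

lemma U_ind (p : ℕ) (S : Submodule ℂ (Uq p)) (h1 : 1 ∈ S)
    (hE : ∀ x ∈ S, UE p * x ∈ S) (hF : ∀ x ∈ S, UF p * x ∈ S)
    (hK : ∀ x ∈ S, UK p * x ∈ S) (hK' : ∀ x ∈ S, UKinv p * x ∈ S) (x : Uq p) : x ∈ S := by
  obtain ⟨a, rfl⟩ := RingQuot.mkAlgHom_surjective ℂ (URel p) x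
  suffices h : ∀ y ∈ S, RingQuot.mkAlgHom ℂ (URel p) a * y ∈ S by
    simpa using h 1 h1
  induction a using FreeAlgebra.induction with
  | grade0 r =>
    intro y hy
    rw [AlgHom.commutes, ← Algebra.smul_def]
    exact S.smul_mem r hy
  | grade1 g =>
    cases g with
    | E => exact hE
    | F => exact hF
    | K => exact hK
    | Kinv => exact hK'
  | mul a b iha ihb =>
    intro y hy
    rw [map_mul, mul_assoc]
    exact iha _ (ihb _ hy)
  | add a b iha ihb =>
    intro y hy
    rw [map_add, add_mul]
    exact S.add_mem (iha _ hy) (ihb _ hy)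

lemma K_mon (p a i m n : ℕ) : ∃ r : ℂ, UK p ^ a * mon p i m n = r • mon p i m (a + n) ∧
    (i = m → r = 1) := by
  refine ⟨(qq p ^ 2)⁻¹ ^ (a * i) * (qq p ^ 2) ^ (a * m), ?_, ?_⟩
  · unfold mon
    rw [← mul_assoc, ← mul_assoc, pow_comm_smul _ _ _ (U_KF p), smul_mul_assoc, mul_assoc,
      pow_comm_smul _ _ _ (U_KE p), mul_smul_comm, smul_smul, smul_mul_assoc, ← mul_assoc,
      mul_assoc, ← pow_add]
  · rintro rfl
    rw [← mul_pow, inv_mul_cancel₀ (q2_ne p), one_pow]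

lemma E_mon (p : ℕ) (hp : 2 ≤ p) (i m n : ℕ) : ∃ a b : ℂ, UE p * mon p (i + 1) m n =
    mon p (i + 1) (m + 1) n + a • mon p i m (1 + n) + b • mon p i m (2 * p - 1 + n) := by
  obtain ⟨a, b, h⟩ := aux_EFpow (UE p) (UF p) (UK p) (UKinv p) _ _ (U_KF p) (U_K'F p) (U_EF p) i
  refine ⟨a * (qq p ^ 2) ^ (1 * m), b * (qq p ^ 2) ^ ((2 * p - 1) * m), ?_⟩
  have e1 := pow_comm_smul _ _ _ (U_KE p) 1 m
  have e2 := pow_comm_smul _ _ _ (U_KE p) (2 * p - 1) m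
  rw [pow_one] at e1
  unfold mon
  rw [← mul_assoc, ← mul_assoc, h, U_K' p hp]
  simp only [add_mul, mul_add, mul_smul_comm, smul_mul_assoc]
  rw [mul_assoc _ (UK p), e1, mul_assoc _ (UK p ^ (2 * p - 1)), e2, mul_assoc _ (UE p), ← pow_succ']
  simp only [mul_smul_comm, smul_mul_assoc, smul_smul, mul_assoc, ← pow_add, ← pow_succ']
  rw [add_comm 1 n, add_assoc]

lemma E_mon0 (p : ℕ) (m n : ℕ) : UE p * mon p 0 m n = mon p 0 (m + 1) n := by
  simp [mon, ← mul_assoc, ← pow_succ']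

lemma mon_E (p i m n : ℕ) (a : ℕ) :
    mon p i m n * UE p ^ a = (qq p ^ 2) ^ (n * a) • mon p i (m + a) n := by
  unfold mon
  rw [mul_assoc _ (UK p ^ n), pow_comm_smul _ _ _ (U_KE p), mul_smul_comm, ← mul_assoc,
    mul_assoc (UF p ^ i), ← pow_add]

lemma F_mon (p i m n : ℕ) (a : ℕ) : UF p ^ a * mon p i m n = mon p (a + i) m n := by
  unfold mon
  rw [← mul_assoc, ← mul_assoc, ← pow_add]

lemma mon_K (p i m n a : ℕ) : mon p i m n * UK p ^ a = mon p i m (n + a) := by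
  unfold mon
  rw [mul_assoc, ← pow_add]

lemma mon_F (p : ℕ) (hp : 2 ≤ p) (i m n : ℕ) : ∃ a b : ℂ, mon p i (m + 1) n * UF p =
    (qq p ^ 2)⁻¹ ^ n • mon p (i + 1) (m + 1) n + a • mon p i m (1 + n) +
      b • mon p i m (2 * p - 1 + n) := by
  obtain ⟨A, B, h⟩ := aux_EpowF' (UE p) (UF p) (UK p) (UKinv p) _ _ (U_KE p) (U_K'E p) (U_EF p) m
  have e := pow_comm_smul _ _ _ (U_KF p) n 1
  rw [mul_one, pow_one] at e
  set r := (qq p ^ 2)⁻¹ ^ n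
  refine ⟨r * A, r * B, ?_⟩
  have e1 : UK p * UK p ^ n = UK p ^ (1 + n) := by rw [pow_add, pow_one]
  unfold mon
  rw [mul_assoc _ (UK p ^ n), e, mul_smul_comm, ← mul_assoc, mul_assoc (UF p ^ i), h, U_K' p hp]
  simp only [mul_add, add_mul, mul_smul_comm, smul_mul_assoc, smul_add, smul_smul, mul_assoc, e1,
    ← pow_add, pow_succ (UF p) i, ← add_assoc]

lemma mon0_F (p : ℕ) (i n : ℕ) : mon p i 0 n * UF p = (qq p ^ 2)⁻¹ ^ n • mon p (i + 1) 0 n := by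
  have e := pow_comm_smul _ _ _ (U_KF p) n 1
  rw [mul_one, pow_one] at e
  simp only [mon, pow_zero, mul_one]
  rw [mul_assoc, e, mul_smul_comm, ← mul_assoc, pow_succ (UF p)]

lemma span_mon (p : ℕ) (hp : 2 ≤ p) (x : Uq p) :
    ∃ c : Fin p × Fin p × Fin (2 * p) → ℂ, ∑ j, c j • mon p j.1 j.2.1 j.2.2 = x := by
  rw [← Submodule.mem_span_range_iff_exists_fun]
  set S := Submodule.span ℂ (Set.range fun j : Fin p × Fin p × Fin (2 * p) =>
    mon p j.1 j.2.1 j.2.2) with hS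
  have hm : ∀ i m n, mon p i m n ∈ S := by
    intro i m n
    by_cases hi : p ≤ i
    · have : mon p i m n = 0 := by
        unfold mon
        rw [pow_eq_zero_of_le hi (U_Fp p)]; simp
      rw [this]; exact S.zero_mem
    by_cases hj : p ≤ m
    · have : mon p i m n = 0 := by
        unfold mon
        rw [pow_eq_zero_of_le hj (U_Ep p)]; simp
      rw [this]; exact S.zero_mem
    have : mon p i m n = mon p i m (n % (2 * p)) := by
      unfold mon
      rw [pow_eq_pow_mod n (U_Kp p)]
    rw [this]
    exact Submodule.subset_span ⟨(⟨i, by omega⟩, ⟨m, by omega⟩, ⟨n % (2 * p), Nat.mod_lt _ (by omega)⟩), rfl⟩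
  have key : ∀ a : Uq p, (∀ i m n, a * mon p i m n ∈ S) → ∀ x ∈ S, a * x ∈ S := by
    intro a ha x hx
    induction hx using Submodule.span_induction with
    | mem x hx => obtain ⟨j, rfl⟩ := hx; exact ha _ _ _
    | zero => simp
    | add x y _ _ hx hy => rw [mul_add]; exact S.add_mem hx hy
    | smul r x _ hx => rw [mul_smul_comm]; exact S.smul_mem r hx
  have hKa : ∀ a, ∀ i m n, UK p ^ a * mon p i m n ∈ S := by
    intro a i m n
    obtain ⟨r, h, _⟩ := K_mon p a i m n
    rw [h]
    exact S.smul_mem _ (hm _ _ _)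
  refine U_ind p S ?_ (key _ ?_) (key _ ?_) (key _ ?_) (key _ ?_) x
  · simpa [mon] using hm 0 0 0
  · intro i m n
    rcases i with _ | i
    · rw [E_mon0]; exact hm _ _ _
    · obtain ⟨a, b, h⟩ := E_mon p hp i m n
      rw [h]
      exact S.add_mem (S.add_mem (hm _ _ _) (S.smul_mem _ (hm _ _ _))) (S.smul_mem _ (hm _ _ _))
  · intro i m n
    rw [← pow_one (UF p), F_mon]; exact hm _ _ _
  · simpa using hKa 1
  · rw [U_K' p hp]; exact hKa _

lemma Tr_symm (p : ℕ) (hp : 2 ≤ p) (t : Uq p →ₗ[ℂ] ℂ)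
    (ht : ∀ i m n, t (mon p i m n) = if i = p - 1 ∧ m = p - 1 ∧ 2 * p ∣ n then 1 else 0)
    (x y : Uq p) : t (x * y) = t (y * x) := by
  have hq : ∀ n, 2 * p ∣ n → (qq p ^ 2) ^ n = 1 := by
    intro n hn
    rw [← pow_mul, mul_comm, pow_mul, (qq_prim p hp).pow_eq_one_iff_dvd n |>.2 hn, one_pow]
  -- reduce to monomials
  have key : ∀ a : Uq p, (∀ i m n, i < p → m < p → t (a * mon p i m n) = t (mon p i m n * a)) →
      ∀ y, t (a * y) = t (y * a) := by
    intro a ha y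
    obtain ⟨c, rfl⟩ := span_mon p hp y
    rw [mul_sum, sum_mul, map_sum, map_sum]
    refine sum_congr rfl fun j _ => ?_
    rw [mul_smul_comm, smul_mul_assoc, map_smul, map_smul, ha _ _ _ j.1.2 j.2.1.2]
  have kK : ∀ a y, t (UK p ^ a * y) = t (y * UK p ^ a) := by
    intro a
    refine key _ fun i m n _ _ => ?_
    obtain ⟨r, h, hr⟩ := K_mon p a i m n
    rw [h, mon_K, map_smul, ht, ht, add_comm a n]
    split_ifs with h1
    · rw [hr (by omega), one_smul]
    · simp
  have kE : ∀ y, t (UE p * y) = t (y * UE p) := by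
    refine key _ fun i m n hi hm => ?_
    have e := mon_E p i m n 1
    rw [pow_one, mul_one] at e
    rw [e, map_smul]
    have e2 : t (UE p * mon p i m n) = t (mon p i (m + 1) n) := by
      rcases i with _ | i
      · rw [E_mon0]
      · obtain ⟨a, b, h⟩ := E_mon p hp i m n
        have hi' : i ≠ p - 1 := by omega
        rw [h, map_add, map_add, map_smul, map_smul, ht i, ht i]
        simp [hi']
    rw [e2, ht]
    split_ifs with h
    · rw [hq n h.2.2, one_smul]
    · simp
  have kF : ∀ y, t (UF p * y) = t (y * UF p) := by
    refine key _ fun i m n hi hm => ?_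
    have e := F_mon p i m n 1
    rw [pow_one, add_comm] at e
    have e2 : t (mon p i m n * UF p) = (qq p ^ 2)⁻¹ ^ n • t (mon p (i + 1) m n) := by
      rcases m with _ | m
      · rw [mon0_F, map_smul]
      · obtain ⟨a, b, h⟩ := mon_F p hp i m n
        have hi' : m ≠ p - 1 := by omega
        rw [h, map_add, map_add, map_smul, map_smul, map_smul, ht i, ht i]
        simp [hi']
    rw [e, e2, ht]
    split_ifs with h
    · rw [inv_pow, hq n h.2.2, inv_one, one_smul]
    · simp
  let S : Submodule ℂ (Uq p) :=
    { carrier := {x | ∀ y, t (x * y) = t (y * x)}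
      add_mem' := by
        intro a b ha hb y
        rw [add_mul, mul_add, map_add, map_add, ha y, hb y]
      zero_mem' := by intro y; simp
      smul_mem' := by
        intro c a ha y
        rw [smul_mul_assoc, mul_smul_comm, map_smul, map_smul, ha y] }
  have hmul : ∀ a : Uq p, (∀ y, t (a * y) = t (y * a)) → ∀ x ∈ S, a * x ∈ S := by
    intro a ha x hx y
    rw [mul_assoc, ha, mul_assoc, hx (y * a), mul_assoc]
  refine U_ind p S (by intro y; simp) (hmul _ kE) (hmul _ kF) (hmul _ ?_) (hmul _ ?_) x y
  · simpa using kK 1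
  · rw [U_K' p hp]; exact kK _

lemma Tr_nondeg (p : ℕ) (hp : 2 ≤ p) (t : Uq p →ₗ[ℂ] ℂ)
    (ht : ∀ i m n, t (mon p i m n) = if i = p - 1 ∧ m = p - 1 ∧ 2 * p ∣ n then 1 else 0)
    (x : Uq p) (h : ∀ y, t (x * y) = 0) : x = 0 := by
  have hs := Tr_symm p hp t ht
  obtain ⟨c, rfl⟩ := span_mon p hp x
  refine sum_eq_zero fun j0 _ => ?_
  suffices hc : c j0 = 0 by rw [hc, zero_smul]
  have h1 := h (UE p ^ (p - 1 - j0.2.1) * UK p ^ (2 * p - j0.2.2) * UF p ^ (p - 1 - j0.1))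
  rw [← mul_assoc, hs, sum_mul, mul_sum, map_sum, sum_eq_single j0] at h1
  · rw [smul_mul_assoc, ← mul_assoc, mon_E, smul_mul_assoc, mon_K, mul_smul_comm, mul_smul_comm, F_mon,
      map_smul, map_smul, ht, if_pos, smul_eq_mul, smul_eq_mul, mul_one] at h1
    · exact (mul_eq_zero.1 h1).resolve_right (pow_ne_zero _ (q2_ne p))
    · have := j0.1.2
      have := j0.2.1.2
      have := j0.2.2.2
      refine ⟨by omega, by omega, ?_⟩
      rw [show (j0.2.2 : ℕ) + (2 * p - j0.2.2) = 2 * p by omega]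
  · intro j _ hj
    rw [smul_mul_assoc, ← mul_assoc, mon_E, smul_mul_assoc, mon_K, mul_smul_comm, mul_smul_comm, F_mon,
      map_smul, map_smul, ht, if_neg, smul_zero, smul_zero]
    rintro ⟨h1, h2, h3⟩
    apply hj
    have := j0.1.2
    have := j0.2.1.2
    have := j0.2.2.2
    have := j.2.2.2
    refine Prod.ext (Fin.ext (by omega)) (Prod.ext (Fin.ext (by omega)) (Fin.ext ?_))
    obtain ⟨k, hk⟩ := h3
    have k1 : k = 1 := by
      have : 0 < k := by
        rcases Nat.eq_zero_or_pos k with rfl | h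
        · omega
        · exact h
      have : k < 2 := by
        by_contra hk2
        have : 2 * p * 2 ≤ 2 * p * k := Nat.mul_le_mul_left _ (by omega)
        omega
      omega
    subst k1
    omega
  · simp

lemma U_fin (p : ℕ) (hp : 2 ≤ p) : FiniteDimensional ℂ (Uq p) := by
  refine Module.Finite.of_surjective (Fintype.linearCombination ℂ
    (fun j : Fin p × Fin p × Fin (2 * p) => mon p j.1 j.2.1 j.2.2)) fun x => ?_
  obtain ⟨c, hc⟩ := span_mon p hp x
  exact ⟨c, by rw [Fintype.linearCombination_apply, hc]⟩

end LogHennings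

open LogHennings in
/-- There is a symmetric linear functional `Tr'` on `U` inducing a
non-degenerate pairing between the center `Z(U)` and `HH₀(U) = U/[U,U]`. -/
theorem modified_trace_nondegenerate (p : ℕ) (hp : 2 ≤ p) :
    ∃ Tr : Uq p →ₗ[ℂ] ℂ,
      (∀ x y : Uq p, Tr (x * y) = Tr (y * x)) ∧
      (∀ z ∈ Subalgebra.center ℂ (Uq p), z ≠ 0 → ∃ x : Uq p, Tr (z * x) ≠ 0) ∧
      (∀ x : Uq p, x ∉ commSpan p →
        ∃ z ∈ Subalgebra.center ℂ (Uq p), Tr (z * x) ≠ 0) := by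
  obtain ⟨t, ht⟩ := Tr_exists p hp
  have hs := Tr_symm p hp t ht
  have hn := Tr_nondeg p hp t ht
  have := U_fin p hp
  refine ⟨t, hs, fun z _ hz => ?_, fun x hx => ?_⟩
  · by_contra! h
    exact hz (hn z h)
  · obtain ⟨f, hf, hle⟩ := Submodule.exists_le_ker_of_notMem hx
    let B : Uq p →ₗ[ℂ] Module.Dual ℂ (Uq p) := (LinearMap.mul ℂ (Uq p)).compr₂ t
    have hB : ∀ a b, B a b = t (a * b) := fun a b => rfl
    have hinj : Function.Injective B := by
      rw [injective_iff_map_eq_zero]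
      intro a ha
      exact hn a fun y => by rw [← hB, ha]; rfl
    have hsurj : Function.Surjective B :=
      (LinearMap.injective_iff_surjective_of_finrank_eq_finrank
        (Subspace.dual_finrank_eq).symm).1 hinj
    obtain ⟨z, rfl⟩ := hsurj f
    refine ⟨z, ?_, hf⟩
    rw [Subalgebra.mem_center_iff]
    intro a
    rw [← sub_eq_zero]
    refine hn _ fun y => ?_
    have hm : a * y - y * a ∈ commSpan p := Submodule.subset_span ⟨a, y, rfl⟩
    have h0 : B z (a * y - y * a) = 0 := hle hm
    rw [hB, mul_sub, map_sub, ← mul_assoc z y a, hs (z * y) a] at h0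
    rw [sub_mul, map_sub, mul_assoc, mul_assoc, ← neg_sub, neg_eq_zero]
    exact h0
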